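/- arXiv:0912.5438 — 2 statements merged into one kernel-verified Lean document; each statement's English description precedes it below -/
import Mathlib

section
/- The polynomial Q obeys the scaling relation: for scalars λ and μ, Q_G(λx, λy, λμ⁻²z, λμ⁻²w, μ·r) = λ^{e(G)} μ^{f(G)} Q_G(x, y, z, w, r), where each edge variable x_e, y_e is multiplied by λ, each z_e, w_e by λμ⁻², (μ·r)_n = μⁿ r_n, and e(G), f(G) are the numbers of edges and flags of G. -/
set_option linter.unusedSectionVars false

open Finset

namespace RibbonPaper

variable {X : Type} [Fintype X] [DecidableEq X]

/-- Raw combinatorial data of a ribbon graph with flags: three permutations of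
the finite set of crosses. -/
structure RawRibbon (X : Type) [Fintype X] [DecidableEq X] where
  s0 : Equiv.Perm X
  th : Equiv.Perm X
  s1 : Equiv.Perm X

namespace RawRibbon

/-- The axioms of a combinatorial map with flags (ribbon graph with flags). -/
def IsRibbon (G : RawRibbon X) : Prop :=
  G.th ^ 2 = 1 ∧ G.s1 ^ 2 = 1 ∧ G.th * G.s1 = G.s1 * G.th ∧
    (∀ x, G.th x ≠ x) ∧ (∀ x, G.th x ≠ G.s1 x) ∧
    G.s0 * G.th = G.th * G.s0⁻¹ ∧
    ∀ (x : X) (n : ℤ), (G.s0 ^ n) x ≠ G.th x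

/-- A ribbon graph without flags: `σ₁` is fixed-point free. -/
def NoFlags (G : RawRibbon X) : Prop := ∀ x, G.s1 x ≠ x

/-- The edges: 4-element orbits `{x, θx, σ₁x, σ₁θx}` of crosses not fixed by `σ₁`. -/
def edges (G : RawRibbon X) : Finset (Finset X) :=
  (Finset.univ.filter fun x => G.s1 x ≠ x).image
    fun x => ({x, G.th x, G.s1 x, G.s1 (G.th x)} : Finset X)

/-- The flags: pairs `{x, θ x}` of crosses fixed by `σ₁`. -/
def flags (G : RawRibbon X) : Finset (Finset X) :=
  (Finset.univ.filter fun x => G.s1 x = x).image fun x => ({x, G.th x} : Finset X)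

/-- The half-ribbons: all pairs `{x, θ x}`. -/
def halfRibbons (G : RawRibbon X) : Finset (Finset X) :=
  Finset.univ.image fun x => ({x, G.th x} : Finset X)

/-- Orbit of a point under a permutation, as a finset. -/
def permOrbit (f : Equiv.Perm X) (x : X) : Finset X :=
  (Finset.range (Fintype.card X)).image fun n => (f ^ n) x

/-- The vertex containing the cross `x`: the union of the `σ₀`-cycles of `x` and `θ x`. -/
def vertexOf (G : RawRibbon X) (x : X) : Finset X :=
  permOrbit G.s0 x ∪ permOrbit G.s0 (G.th x)

/-- The vertices of the ribbon graph, as finsets of crosses. -/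
def vertices (G : RawRibbon X) : Finset (Finset X) :=
  Finset.univ.image G.vertexOf

/-- `degB G B v` : the number of half-edges incident to `v` that belong to edges of `B`,
plus the number of flags incident to `v`. -/
def degB (G : RawRibbon X) (B : Finset (Finset X)) (v : Finset X) : ℕ :=
  (G.halfRibbons.filter fun h => h ⊆ v ∧ (h ∈ G.flags ∨ ∃ e ∈ B, h ⊆ e)).card

/-- `φ_S` : the permutation agreeing with `f` on `S` and the identity off `S`
(defined whenever `S` is `f`-invariant, and the identity otherwise). -/
def permRestrict (f : Equiv.Perm X) (S : Finset X) : Equiv.Perm X :=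
  if h : ∀ x : X, x ∈ S ↔ f x ∈ S then Equiv.Perm.ofSubtype (f.subtypePerm fun x => (h x).symm) else 1

/-- The set of crosses of a set of edges. -/
def crossSet (E' : Finset (Finset X)) : Finset X := E'.biUnion id

/-- Chmutov's partial dual `G^{E'}`. -/
def partialDual (G : RawRibbon X) (E' : Finset (Finset X)) : RawRibbon X where
  s0 := G.s0 * permRestrict G.th (crossSet E') * permRestrict G.s1 (crossSet E')
  th := permRestrict G.s1 (crossSet E') * permRestrict G.th (crossSet E')ᶜ
  s1 := permRestrict G.s1 (crossSet E')ᶜ * permRestrict G.th (crossSet E')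

/-- The topological polynomial `Q` of a ribbon graph with flags. -/
def Qpoly {R : Type} [CommRing R] (G : RawRibbon X) (x y z w : Finset X → R) (r : ℕ → R) : R :=
  ∑ A ∈ G.edges.powerset, ∑ B ∈ (G.partialDual A).edges.powerset,
    (∏ e ∈ (G.edges \ A) ∩ ((G.partialDual A).edges \ B), x e) *
      (∏ e ∈ A ∩ ((G.partialDual A).edges \ B), y e) *
      (∏ e ∈ A ∩ B, z e) *
      (∏ e ∈ (G.edges \ A) ∩ B, w e) *
      ∏ v ∈ (G.partialDual A).vertices, r (degB (G.partialDual A) B v)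

/-- The first hyperbolic polynomial `HU` as an evaluation of `Q`. -/
noncomputable def HU (G : RawRibbon X) (Ω t : Finset X → ℝ) : ℝ :=
  Qpoly G t Ω (fun e => Ω e * t e ^ 2) (fun e => t e * Ω e ^ 2)
    fun n => if Even n then 0 else 2

end RawRibbon

end RibbonPaper

theorem test : True := trivial
namespace RibbonPaper

namespace RawRibbon

variable {X : Type} [Fintype X] [DecidableEq X]

lemma firstRet_exists (f : Equiv.Perm X) (S : Finset X) {x : X} (hx : x ∈ S) :
    ∃ k : ℕ, 0 < k ∧ (f ^ k) x ∈ S :=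
  ⟨orderOf f, orderOf_pos f, by rw [pow_orderOf_eq_one]; simpa using hx⟩

open scoped Classical in
/-- The first-return map of a permutation on a subset. -/
noncomputable def firstRet (f : Equiv.Perm X) (S : Finset X) (x : X) : X :=
  if h : ∃ k : ℕ, 0 < k ∧ (f ^ k) x ∈ S then (f ^ Nat.find h) x else x

lemma firstRet_mem (f : Equiv.Perm X) (S : Finset X) {x : X} (hx : x ∈ S) :
    firstRet f S x ∈ S := by
  rw [firstRet, dif_pos (firstRet_exists f S hx)]
  exact (Nat.find_spec (firstRet_exists f S hx)).2

lemma firstRet_inj_aux (f : Equiv.Perm X) (S : Finset X) {x y : X}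
    (hx : x ∈ S) (hy : y ∈ S)
    (hle : Nat.find (firstRet_exists f S hx) ≤ Nat.find (firstRet_exists f S hy))
    (h : firstRet f S x = firstRet f S y) : x = y := by
  have hex := firstRet_exists f S hx
  have hey := firstRet_exists f S hy
  rw [firstRet, dif_pos hex, firstRet, dif_pos hey] at h
  have hxy : x = (f ^ (Nat.find hey - Nat.find hex)) y := by
    apply Equiv.injective (f ^ Nat.find hex)
    rw [← Equiv.Perm.mul_apply, ← pow_add, Nat.add_sub_cancel' hle]
    exact h
  by_cases h0 : Nat.find hey - Nat.find hex = 0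
  · rw [h0, pow_zero] at hxy
    simpa using hxy
  · exfalso
    have hlt : Nat.find hey - Nat.find hex < Nat.find hey :=
      Nat.sub_lt (Nat.find_spec hey).1 (Nat.find_spec hex).1
    apply Nat.find_min hey hlt
    refine ⟨Nat.pos_of_ne_zero h0, ?_⟩
    rw [hxy] at hx
    exact hx

lemma firstRet_inj (f : Equiv.Perm X) (S : Finset X) {x y : X}
    (hx : x ∈ S) (hy : y ∈ S) (h : firstRet f S x = firstRet f S y) : x = y := by
  rcases le_total (Nat.find (firstRet_exists f S hx)) (Nat.find (firstRet_exists f S hy)) with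
    hle | hle
  · exact firstRet_inj_aux f S hx hy hle h
  · exact (firstRet_inj_aux f S hy hx hle h.symm).symm

/-- The permutation induced on a subset `S` by a permutation of `X`
(the first-return map). -/
noncomputable def inducedPerm (f : Equiv.Perm X) (S : Finset X) : Equiv.Perm {x : X // x ∈ S} :=
  Equiv.ofBijective (fun a => ⟨firstRet f S a.1, firstRet_mem f S a.2⟩)
    (Finite.injective_iff_bijective.mp fun a b hab =>
      Subtype.ext (firstRet_inj f S a.2 b.2 (congrArg Subtype.val hab)))

/-- The ribbon graph obtained by restricting to a subset `S` of the crosses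
(deleting all crosses outside `S`). -/
noncomputable def restrict (G : RawRibbon X) (S : Finset X) : RawRibbon {x : X // x ∈ S} :=
  ⟨inducedPerm G.s0 S, inducedPerm G.th S, inducedPerm G.s1 S⟩

/-- Deletion of an edge `e` (given by its finset of crosses). -/
noncomputable def delete (G : RawRibbon X) (e : Finset X) : RawRibbon {x : X // x ∈ eᶜ} :=
  G.restrict eᶜ

/-- The cut of an edge `e`: `σ₁` is replaced by `(σ₁)_{X∖e}`, so the two
half-edges of `e` become flags. -/
def cut (G : RawRibbon X) (e : Finset X) : RawRibbon X :=
  ⟨G.s0, G.th, permRestrict G.s1 eᶜ⟩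

/-- Connectivity: the crosses form a single orbit under the group generated by the
three permutations. -/
def Connected (G : RawRibbon X) : Prop :=
  ∀ x y : X, ∃ g ∈ Subgroup.closure ({G.s0, G.th, G.s1} : Set (Equiv.Perm X)), g x = y

/-- Two vertices are linked by an edge of `A` if `e ∈ A` has a half-edge incident to each. -/
def linked (G : RawRibbon X) (A : Finset (Finset X)) (u v : Finset X) : Prop :=
  ∃ e ∈ A, (∃ h ∈ G.halfRibbons, h ⊆ e ∧ h ⊆ u) ∧ ∃ h ∈ G.halfRibbons, h ⊆ e ∧ h ⊆ v

/-- Connectivity of two vertices in the spanning subgraph `(V(G), A)`. -/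
def vconn (G : RawRibbon X) (A : Finset (Finset X)) : Finset X → Finset X → Prop :=
  Relation.ReflTransGen (G.linked A)

/-- The spanning subgraph `(V(G), A)` is connected. -/
def SpanningConn (G : RawRibbon X) (A : Finset (Finset X)) : Prop :=
  ∀ u ∈ G.vertices, ∀ v ∈ G.vertices, G.vconn A u v

/-- The number of faces (boundary components) of a ribbon graph: the number of
vertices of its natural dual. -/
def nFaces (G : RawRibbon X) : ℕ := (G.partialDual G.edges).vertices.card

/-- The number of boundary components of the spanning subgraph of `G` with surviving
crosses `S`, counting also the vertices of `G` that have become isolated. -/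
noncomputable def nBoundary (G : RawRibbon X) (S : Finset X) : ℕ :=
  (G.restrict S).nFaces + (G.vertices.filter fun v => Disjoint v S).card

/-- A spanning quasi-tree: the spanning subgraph `(V(G), A)` is connected and has
exactly one face. -/
def IsQuasiTree (G : RawRibbon X) (A : Finset (Finset X)) : Prop :=
  G.SpanningConn A ∧ G.nBoundary (crossSet A) = 1

/-- A spanning tree: the spanning subgraph `(V(G), A)` is connected and
`|A| = v(G) - 1`. -/
def IsSpanningTree (G : RawRibbon X) (A : Finset (Finset X)) : Prop :=
  G.SpanningConn A ∧ A.card + 1 = G.vertices.card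

open scoped Classical in
/-- The first Symanzik polynomial of the noncommutative heat-kernel theory. -/
noncomputable def Upoly (G : RawRibbon X) (α : Finset X → ℝ) (θ : ℝ) : ℝ :=
  ∑ A ∈ G.edges.powerset.filter (fun A => G.IsQuasiTree A),
    (θ / 2) ^ (A.card + 1 - G.vertices.card) * ∏ e ∈ G.edges \ A, α e

end RawRibbon

end RibbonPaper
namespace RibbonPaper

namespace RawRibbon

variable {X : Type} [Fintype X] [DecidableEq X]

/-- Even spanning subgraphs of `G`. -/
def evenSubs (G : RawRibbon X) : Finset (Finset (Finset X)) :=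
  G.edges.powerset.filter fun B => ∀ v ∈ G.vertices, Even (G.degB B v)

/-- Odd spanning subgraphs of `G`. -/
def oddSubs (G : RawRibbon X) : Finset (Finset (Finset X)) :=
  G.edges.powerset.filter fun B => ∀ v ∈ G.vertices, Odd (G.degB B v)

/-- Odd cutting spanning subgraphs of `G`: subsets of half-ribbons such that every
vertex is incident to an odd number of them. -/
def oddCutting (G : RawRibbon X) : Finset (Finset (Finset X)) :=
  G.halfRibbons.powerset.filter fun H =>
    ∀ v ∈ G.vertices, Odd ((H.filter fun h => h ⊆ v).card)

/-- Even cutting spanning subgraphs of `G`. -/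
def evenCutting (G : RawRibbon X) : Finset (Finset (Finset X)) :=
  G.halfRibbons.powerset.filter fun H =>
    ∀ v ∈ G.vertices, Even ((H.filter fun h => h ⊆ v).card)

/-- The flag-set of a cutting spanning subgraph `H`: the flags of `G` contained in `H`
together with the edges exactly one of whose two half-edges lies in `H`. -/
def flagSetOf (G : RawRibbon X) (H : Finset (Finset X)) : Finset (Finset X) :=
  (G.flags ∩ H) ∪ (G.edges.filter fun e => (H.filter fun h => h ⊆ e).card = 1)

/-- Orientability of a ribbon graph with flags. -/
def Orientable (G : RawRibbon X) : Prop :=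
  ∃ Xp : Finset X,
    Xp.image G.s0 = Xp ∧ Disjoint Xp (Xp.image G.th) ∧
      Xp ∪ Xp.image G.th = Finset.univ ∧
      ∀ x : X, G.s1 x ≠ x → (x ∈ Xp ↔ G.s1 x ∉ Xp)

/-- The edge variable of the edge of `G` containing the half-ribbon `h`
(as a product over the containing edges; a flag contributes `1`). -/
def halfWeight {R : Type} [CommRing R] (G : RawRibbon X) (t : Finset X → R)
    (h : Finset X) : R :=
  ∏ e ∈ G.edges.filter (fun e => h ⊆ e), t e

/-- The vertex containing a given half-ribbon. -/
def vertexOfHalf (G : RawRibbon X) (h : Finset X) : Finset X :=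
  (G.vertices.filter fun v => h ⊆ v).sup id

/-- The spin product `σ_u σ_{u'}` over the endpoints of an edge `e`, for the spin
configuration assigning `+1` to vertices in `T` and `-1` to the others. -/
noncomputable def spinProd (G : RawRibbon X) (T : Finset (Finset X)) (e : Finset X) : ℝ :=
  ∏ h ∈ G.halfRibbons.filter (fun h => h ⊆ e),
    (if G.vertexOfHalf h ∈ T then (1 : ℝ) else -1)

/-- An isolated vertex of even degree: incident to no half-edge and to an even
number of flags. -/
def IsIsolatedEvenVertex (G : RawRibbon X) (v : Finset X) : Prop :=
  v ∈ G.vertices ∧ (∀ h ∈ G.halfRibbons, h ⊆ v → h ∈ G.flags) ∧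
    Even ((G.flags.filter fun h => h ⊆ v).card)

open scoped Classical in
/-- The number of endpoints of edges of `B` lying in the `A`-connected component of the
vertex `v`, plus the number of flags attached to vertices of that component. -/
noncomputable def compDeg (G : RawRibbon X) (A B : Finset (Finset X)) (v : Finset X) : ℕ :=
  (G.halfRibbons.filter fun h =>
      (h ∈ G.flags ∨ ∃ e ∈ B, h ⊆ e) ∧ ∃ u ∈ G.vertices, G.vconn A v u ∧ h ⊆ u).card

/-- `(B, V(G/A))` is odd: every connected component of the spanning subgraph
`(V(G), A)` sees an odd number of endpoints of edges of `B` plus flags. -/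
def CompOdd (G : RawRibbon X) (A B : Finset (Finset X)) : Prop :=
  ∀ v ∈ G.vertices, Odd (compDeg G A B v)

open scoped Classical in
/-- The connected component of the vertex `v` in the spanning subgraph `(V(G), A)`. -/
noncomputable def compVerts (G : RawRibbon X) (A : Finset (Finset X)) (v : Finset X) :
    Finset (Finset X) :=
  G.vertices.filter fun u => G.vconn A v u

/-- The connected components of the spanning subgraph `(V(G), A)`. -/
noncomputable def components (G : RawRibbon X) (A : Finset (Finset X)) :
    Finset (Finset (Finset X)) :=
  G.vertices.image fun v => compVerts G A v

/-- The edges of `A` incident to a set of vertices `c`. -/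
def compEdges (G : RawRibbon X) (A : Finset (Finset X)) (c : Finset (Finset X)) :
    Finset (Finset X) :=
  A.filter fun e => ∃ h ∈ G.halfRibbons, h ⊆ e ∧ ∃ u ∈ c, h ⊆ u

open scoped Classical in
/-- The cycle edges of a (unicyclic) component `c`: those edges whose removal keeps
the component connected. -/
noncomputable def cycleEdges (G : RawRibbon X) (A : Finset (Finset X))
    (c : Finset (Finset X)) : Finset (Finset X) :=
  (compEdges G A c).filter fun e => ∀ u ∈ c, ∀ u' ∈ c, G.vconn (A.erase e) u u'

/-- The weight of a connected component in the commutative Mehler-kernel limit. -/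
noncomputable def compWeight (G : RawRibbon X) (A : Finset (Finset X)) (Ω t : Finset X → ℝ)
    (c : Finset (Finset X)) : ℝ :=
  if (compEdges G A c).card + 1 = c.card then
    (2 : ℝ) ^ (1 - ((compEdges G A c).card : ℤ)) *
      ∑ e ∈ compEdges G A c,
        Ω e ^ 2 * t e * ∏ e' ∈ (compEdges G A c).erase e, Ω e' * (1 + t e' ^ 2)
  else
    (2 : ℝ) ^ (2 - ((compEdges G A c).card : ℤ)) *
      ∑ C' ∈ (cycleEdges G A c).powerset.filter (fun C' => Odd C'.card),
        (∏ e ∈ C', Ω e * t e ^ 2) *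
          ∏ e' ∈ compEdges G A c \ cycleEdges G A c, Ω e' * (1 + t e' ^ 2)

/-- The graph `Ĝ_{i₀}` : the half-edge `i₀` (with crosses `x₀, θ x₀`) is detached from
its vertex, replaced there by a flag (crosses `inr 0, inr 1`), and attached to a new
bivalent vertex carrying one more flag (crosses `inr 2, inr 3`). -/
def hatGraph (G : RawRibbon X) (x₀ : X) : RawRibbon (X ⊕ Fin 4) where
  s0 :=
    (Equiv.swap (Sum.inl x₀) (Sum.inr 0) * Equiv.swap (Sum.inl (G.th x₀)) (Sum.inr 1)) *
        Equiv.sumCongr G.s0 (Equiv.refl (Fin 4)) *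
        (Equiv.swap (Sum.inl x₀) (Sum.inr 0) * Equiv.swap (Sum.inl (G.th x₀)) (Sum.inr 1))⁻¹ *
      Equiv.swap (Sum.inl x₀) (Sum.inr 2) * Equiv.swap (Sum.inl (G.th x₀)) (Sum.inr 3)
  th := Equiv.sumCongr G.th (Equiv.swap 0 1 * Equiv.swap 2 3)
  s1 := Equiv.sumCongr G.s1 (Equiv.refl (Fin 4))

end RawRibbon

end RibbonPaper
namespace RibbonPaper

namespace RawRibbon

section Scaling

variable {X : Type} [Fintype X] [DecidableEq X]

/-- The part of the ribbon axioms which is used for counting. -/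
structure Pre (G : RawRibbon X) : Prop where
  tt : ∀ x, G.th (G.th x) = x
  ss : ∀ x, G.s1 (G.s1 x) = x
  ts : ∀ x, G.th (G.s1 x) = G.s1 (G.th x)
  tne : ∀ x, G.th x ≠ x
  tns : ∀ x, G.th x ≠ G.s1 x
  st : ∀ x, G.s0 (G.th (G.s0 x)) = G.th x

lemma IsRibbon.pre {G : RawRibbon X} (h : G.IsRibbon) : G.Pre := by
  obtain ⟨h1, h2, h3, h4, h5, h6, _⟩ := h
  refine ⟨fun x => ?_, fun x => ?_, fun x => ?_, h4, h5, fun x => ?_⟩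
  · have := Equiv.congr_fun h1 x
    simpa [pow_two] using this
  · have := Equiv.congr_fun h2 x
    simpa [pow_two] using this
  · exact Equiv.congr_fun h3 x
  · have := Equiv.congr_fun h6 (G.s0 x)
    simpa using this

lemma permRestrict_apply (f : Equiv.Perm X) (S : Finset X) (h : ∀ x : X, x ∈ S ↔ f x ∈ S)
    (x : X) : permRestrict f S x = if x ∈ S then f x else x := by
  rw [permRestrict, dif_pos h]
  split_ifs with hx
  · rw [Equiv.Perm.ofSubtype_apply_of_mem _ hx]; rfl
  · rw [Equiv.Perm.ofSubtype_apply_of_not_mem _ hx]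

/-- The edge through a cross. -/
def edgeOf (G : RawRibbon X) (x : X) : Finset X := {x, G.th x, G.s1 x, G.s1 (G.th x)}

lemma mem_edges {G : RawRibbon X} {e : Finset X} :
    e ∈ G.edges ↔ ∃ x, G.s1 x ≠ x ∧ G.edgeOf x = e := by
  simp [edges, edgeOf]

lemma mem_flags {G : RawRibbon X} {e : Finset X} :
    e ∈ G.flags ↔ ∃ x, G.s1 x = x ∧ ({x, G.th x} : Finset X) = e := by
  simp [flags]

lemma mem_half {G : RawRibbon X} {e : Finset X} :
    e ∈ G.halfRibbons ↔ ∃ x, ({x, G.th x} : Finset X) = e := by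
  simp [halfRibbons]

lemma Pre.edge_eq {G : RawRibbon X} (h : G.Pre) {x y : X} (hy : y ∈ G.edgeOf x) :
    G.edgeOf y = G.edgeOf x := by
  have h1 := h.tt
  have h2 := h.ss
  have h3 := h.ts
  simp only [edgeOf, mem_insert, mem_singleton] at hy
  rcases hy with rfl | rfl | rfl | rfl <;> ext a <;> simp only [edgeOf, mem_insert, mem_singleton, h1, h2, h3] <;> tauto

lemma self_mem_edgeOf (G : RawRibbon X) (x : X) : x ∈ G.edgeOf x := by simp [edgeOf]

lemma Pre.not_fix {G : RawRibbon X} (h : G.Pre) {x y : X} (hx : G.s1 x ≠ x)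
    (hy : y ∈ G.edgeOf x) : G.s1 y ≠ y := by
  have h1 := h.tt
  have h2 := h.ss
  have h3 := h.ts
  have key : G.s1 (G.th x) ≠ G.th x := by
    rw [← h3]; exact fun hh => hx (G.th.injective hh)
  simp only [edgeOf, mem_insert, mem_singleton] at hy
  rcases hy with rfl | rfl | rfl | rfl
  · exact hx
  · exact key
  · rw [h2]; exact hx.symm
  · rw [h2]; exact key.symm

section dual


lemma Pre.mem_cross {G : RawRibbon X} (h : G.Pre) {A : Finset (Finset X)}
    (hA : A ⊆ G.edges) (x : X) : x ∈ crossSet A ↔ G.s1 x ≠ x ∧ G.edgeOf x ∈ A := by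
  simp only [crossSet, mem_biUnion, id]
  constructor
  · rintro ⟨e, he, hx⟩
    obtain ⟨y, hy, rfl⟩ := mem_edges.1 (hA he)
    exact ⟨h.not_fix hy hx, by rwa [h.edge_eq hx]⟩
  · rintro ⟨_, h2⟩
    exact ⟨_, h2, self_mem_edgeOf G x⟩

lemma Pre.cross_of_mem {G : RawRibbon X} (h : G.Pre) {A : Finset (Finset X)}
    (hA : A ⊆ G.edges) {x y : X} (hy : y ∈ G.edgeOf x) (hx : x ∈ crossSet A) :
    y ∈ crossSet A := by
  rw [h.mem_cross hA] at hx ⊢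
  exact ⟨h.not_fix hx.1 hy, by rw [h.edge_eq hy]; exact hx.2⟩

lemma Pre.cross_th {G : RawRibbon X} (h : G.Pre) {A : Finset (Finset X)}
    (hA : A ⊆ G.edges) (x : X) : x ∈ crossSet A ↔ G.th x ∈ crossSet A := by
  refine ⟨h.cross_of_mem hA (by simp [edgeOf]), h.cross_of_mem hA (by simp [edgeOf, h.tt])⟩

lemma Pre.cross_s1 {G : RawRibbon X} (h : G.Pre) {A : Finset (Finset X)}
    (hA : A ⊆ G.edges) (x : X) : x ∈ crossSet A ↔ G.s1 x ∈ crossSet A := by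
  refine ⟨h.cross_of_mem hA (by simp [edgeOf]), h.cross_of_mem hA (by simp [edgeOf, h.ss])⟩

lemma Pre.dual_th {G : RawRibbon X} (h : G.Pre) {A : Finset (Finset X)}
    (hA : A ⊆ G.edges) (x : X) :
    (G.partialDual A).th x = if x ∈ crossSet A then G.s1 x else G.th x := by
  have c1 := h.cross_th hA
  have c2 := h.cross_s1 hA
  simp only [partialDual, Equiv.Perm.mul_apply]
  rw [permRestrict_apply G.s1 _ c2, permRestrict_apply G.th _ (by simpa using fun x => not_congr (c1 x))]
  by_cases hx : x ∈ crossSet A <;> simp [hx, ← c1, ← c2]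

lemma Pre.dual_s1 {G : RawRibbon X} (h : G.Pre) {A : Finset (Finset X)}
    (hA : A ⊆ G.edges) (x : X) :
    (G.partialDual A).s1 x = if x ∈ crossSet A then G.th x else G.s1 x := by
  have c1 := h.cross_th hA
  have c2 := h.cross_s1 hA
  simp only [partialDual, Equiv.Perm.mul_apply]
  rw [permRestrict_apply G.th _ c1, permRestrict_apply G.s1 _ (by simpa using fun x => not_congr (c2 x))]
  by_cases hx : x ∈ crossSet A <;> simp [hx, ← c1, ← c2]

lemma Pre.dual_s0 {G : RawRibbon X} (h : G.Pre) {A : Finset (Finset X)}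
    (hA : A ⊆ G.edges) (x : X) :
    (G.partialDual A).s0 x = if x ∈ crossSet A then G.s0 (G.th (G.s1 x)) else G.s0 x := by
  have c1 := h.cross_th hA
  have c2 := h.cross_s1 hA
  simp only [partialDual, Equiv.Perm.mul_apply]
  rw [permRestrict_apply G.th _ c1, permRestrict_apply G.s1 _ c2]
  by_cases hx : x ∈ crossSet A <;> simp [hx, ← c1, ← c2]

lemma Pre.dual {G : RawRibbon X} (h : G.Pre) {A : Finset (Finset X)}
    (hA : A ⊆ G.edges) : (G.partialDual A).Pre := by
  have c1 := h.cross_th hA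
  have c2 := h.cross_s1 hA
  have d1 := h.dual_th hA
  have d2 := h.dual_s1 hA
  have d3 := h.dual_s0 hA
  have h1 := h.tt
  have h2 := h.ss
  have h3 := h.ts
  have h4 := h.st
  refine ⟨fun x => ?_, fun x => ?_, fun x => ?_, fun x => ?_, fun x => ?_, fun x => ?_⟩
  · by_cases hx : x ∈ crossSet A <;> simp [hx, d1, d2, ← c1, ← c2, h1, h2, h3]
  · by_cases hx : x ∈ crossSet A <;> simp [hx, d1, d2, ← c1, ← c2, h1, h2, h3]
  · by_cases hx : x ∈ crossSet A <;> simp [hx, d1, d2, ← c1, ← c2, h1, h2, h3]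
  · rw [d1]
    split_ifs with hx
    · exact ((h.mem_cross hA x).1 hx).1
    · exact h.tne x
  · rw [d1, d2]
    split_ifs with hx
    · exact (h.tns x).symm
    · exact h.tns x
  · have key : ∀ y, (G.partialDual A).s0 ((G.partialDual A).th y) = G.s0 (G.th y) := by
      intro y
      rw [d1]
      by_cases hy : y ∈ crossSet A <;> simp [hy, d3, ← c1, ← c2, h2]
    rw [key, d3, d1]
    split_ifs with hx
    · rw [h4, h1]
    · rw [h4]

lemma Pre.dual_edges {G : RawRibbon X} (h : G.Pre) {A : Finset (Finset X)}
    (hA : A ⊆ G.edges) : (G.partialDual A).edges = G.edges := by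
  ext e
  rw [mem_edges, mem_edges]
  refine exists_congr fun x => ?_
  have d1 := h.dual_th hA
  have d2 := h.dual_s1 hA
  have c1 := h.cross_th hA x
  have c2 := h.cross_s1 hA x
  by_cases hx : x ∈ crossSet A
  · have e1 : (G.partialDual A).edgeOf x = G.edgeOf x := by
      simp only [edgeOf, d1, d2, hx, c2.1 hx, if_true, h.ts]
      ext a; simp only [mem_insert, mem_singleton]; tauto
    rw [e1, d2, if_pos hx]
    simp [h.tne x, ((h.mem_cross hA x).1 hx).1]
  · have e1 : (G.partialDual A).edgeOf x = G.edgeOf x := by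
      simp only [edgeOf, d1, d2, hx, mt c1.2 hx, if_false]
    rw [e1, d2, if_neg hx]

lemma Pre.dual_flags {G : RawRibbon X} (h : G.Pre) {A : Finset (Finset X)}
    (hA : A ⊆ G.edges) : (G.partialDual A).flags = G.flags := by
  ext e
  rw [mem_flags, mem_flags]
  refine exists_congr fun x => ?_
  rw [h.dual_th hA, h.dual_s1 hA]
  split_ifs with hx
  · simp [h.tne x, ((h.mem_cross hA x).1 hx).1]
  · rfl

end dual

lemma mem_permOrbit (f : Equiv.Perm X) (x y : X) : y ∈ permOrbit f x ↔ f.SameCycle x y := by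
  simp only [permOrbit, mem_image, mem_range]
  constructor
  · rintro ⟨n, _, rfl⟩
    exact ⟨n, by simp⟩
  · intro hc
    have : ∃ n : ℕ, (f ^ n) x = y := by
      obtain ⟨n, _, hn⟩ := hc.exists_pow_eq''
      exact ⟨n, hn.2⟩
    obtain ⟨n, rfl⟩ := this
    have hp : 0 < Function.minimalPeriod f x :=
      Function.minimalPeriod_pos_of_mem_periodicPts
        (f.injective.mem_periodicPts x)
    refine ⟨n % Function.minimalPeriod f x, ?_, ?_⟩
    · refine (Nat.mod_lt _ hp).trans_le ?_
      exact Function.minimalPeriod_le_card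
    · rw [← Equiv.Perm.iterate_eq_pow, ← Equiv.Perm.iterate_eq_pow,
        Function.iterate_mod_minimalPeriod_eq]

lemma Pre.same_th {G : RawRibbon X} (h : G.Pre) {x y : X} (hc : G.s0.SameCycle x y) :
    G.s0.SameCycle (G.th x) (G.th y) := by
  have key : ∀ (n : ℕ) (x : X), (G.s0 ^ n) (G.th ((G.s0 ^ n) x)) = G.th x := by
    intro n
    induction n with
    | zero => intro x; simp
    | succ n ih =>
      intro x
      rw [pow_succ', Equiv.Perm.mul_apply, Equiv.Perm.mul_apply, ← Equiv.Perm.mul_apply,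
        ← pow_succ', pow_succ, Equiv.Perm.mul_apply, h.st, ih]
  obtain ⟨n, _, hn⟩ := hc.exists_pow_eq''
  obtain ⟨_, rfl⟩ := hn
  exact Equiv.Perm.SameCycle.symm ⟨n, by rw [zpow_natCast, key]⟩

lemma mem_vertexOf (G : RawRibbon X) (x y : X) :
    y ∈ G.vertexOf x ↔ G.s0.SameCycle x y ∨ G.s0.SameCycle (G.th x) y := by
  simp only [vertexOf, mem_union, mem_permOrbit]

lemma Pre.vertexOf_eq {G : RawRibbon X} (h : G.Pre) {x y : X} (hy : y ∈ G.vertexOf x) :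
    G.vertexOf y = G.vertexOf x := by
  rw [mem_vertexOf] at hy
  ext a
  rw [mem_vertexOf, mem_vertexOf]
  rcases hy with hy | hy
  · have h1 := h.same_th hy
    exact or_congr ⟨hy.trans, hy.symm.trans⟩ ⟨h1.trans, h1.symm.trans⟩
  · have h1 := h.same_th hy
    rw [h.tt] at h1
    rw [or_comm]
    exact or_congr ⟨h1.trans, h1.symm.trans⟩ ⟨hy.trans, hy.symm.trans⟩

lemma Pre.half_vertex {G : RawRibbon X} (h : G.Pre) {k : Finset X} (hk : k ∈ G.halfRibbons) :
    (G.vertices.filter fun v => k ⊆ v).card = 1 := by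
  obtain ⟨x, rfl⟩ := mem_half.1 hk
  rw [card_eq_one]
  refine ⟨G.vertexOf x, ?_⟩
  ext v
  simp only [mem_filter, mem_singleton, vertices, mem_image, mem_univ, true_and]
  constructor
  · rintro ⟨⟨y, rfl⟩, hy⟩
    exact (h.vertexOf_eq (hy (by simp))).symm
  · rintro rfl
    refine ⟨⟨x, rfl⟩, ?_⟩
    intro a ha
    simp only [mem_insert, mem_singleton] at ha
    rw [mem_vertexOf]
    rcases ha with rfl | rfl
    · exact Or.inl (Equiv.Perm.SameCycle.refl _ _)
    · exact Or.inr (Equiv.Perm.SameCycle.refl _ _)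

lemma Pre.edge_half {G : RawRibbon X} (h : G.Pre) {e : Finset X} (he : e ∈ G.edges) :
    (G.halfRibbons.filter fun k => k ⊆ e).card = 2 := by
  obtain ⟨x, hx, rfl⟩ := mem_edges.1 he
  have h1 := h.tt
  have h2 := h.ss
  have h3 := h.ts
  rw [card_eq_two]
  refine ⟨{x, G.th x}, {G.s1 x, G.th (G.s1 x)}, ?_, ?_⟩
  · intro hh
    have : G.s1 x ∈ ({x, G.th x} : Finset X) := by rw [hh]; simp
    simp only [mem_insert, mem_singleton] at this
    rcases this with h' | h'
    · exact hx h'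
    · exact h.tns x h'.symm
  · ext k
    simp only [mem_filter, mem_half, mem_insert, mem_singleton]
    constructor
    · rintro ⟨⟨y, rfl⟩, hy⟩
      have hy : y ∈ G.edgeOf x := hy (by simp)
      simp only [edgeOf, mem_insert, mem_singleton] at hy
      rcases hy with rfl | rfl | rfl | rfl
      · exact Or.inl rfl
      · left; rw [h1, pair_comm]
      · exact Or.inr rfl
      · right; rw [← h3, h1, pair_comm]
    · rintro (rfl | rfl)
      · refine ⟨⟨x, rfl⟩, ?_⟩
        intro a; simp only [edgeOf, mem_insert, mem_singleton]; tauto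
      · refine ⟨⟨G.s1 x, rfl⟩, ?_⟩
        intro a; simp only [edgeOf, mem_insert, mem_singleton, h3]; tauto

lemma Pre.sum_degB {G : RawRibbon X} (h : G.Pre) {B : Finset (Finset X)} (hB : B ⊆ G.edges) :
    ∑ v ∈ G.vertices, G.degB B v = 2 * B.card + G.flags.card := by
  have step1 : ∑ v ∈ G.vertices, G.degB B v =
      (G.halfRibbons.filter fun k => k ∈ G.flags ∨ ∃ e ∈ B, k ⊆ e).card := by
    have : ∀ v, G.degB B v = ∑ k ∈ G.halfRibbons.filter (fun k => k ∈ G.flags ∨ ∃ e ∈ B, k ⊆ e),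
        if k ⊆ v then 1 else 0 := by
      intro v
      rw [← card_filter, filter_filter, degB]
      simp only [and_comm]
    simp only [this]
    rw [sum_comm, card_eq_sum_ones]
    refine sum_congr rfl fun k hk => ?_
    rw [← card_filter]
    exact h.half_vertex (mem_filter.1 hk).1
  have step2 : (G.halfRibbons.filter fun k => k ∈ G.flags ∨ ∃ e ∈ B, k ⊆ e) =
      (B.biUnion fun e => G.halfRibbons.filter fun k => k ⊆ e) ∪ G.flags := by
    ext k
    simp only [mem_filter, mem_union, mem_biUnion]
    constructor
    · rintro ⟨hk, hf | ⟨e, he, hke⟩⟩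
      · exact Or.inr hf
      · exact Or.inl ⟨e, he, hk, hke⟩
    · rintro (⟨e, he, hk, hke⟩ | hf)
      · exact ⟨hk, Or.inr ⟨e, he, hke⟩⟩
      · obtain ⟨x, _, rfl⟩ := mem_flags.1 hf
        exact ⟨mem_half.2 ⟨x, rfl⟩, Or.inl hf⟩
  rw [step1, step2, card_union_of_disjoint, card_biUnion]
  · rw [sum_congr rfl fun e he => h.edge_half (hB he)]
    simp [mul_comm]
  · intro e he e' he' hne
    change Disjoint _ _
    rw [disjoint_left]
    intro k hk hk'
    obtain ⟨hk1, hke⟩ := mem_filter.1 hk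
    obtain ⟨_, hke'⟩ := mem_filter.1 hk'
    obtain ⟨y, rfl⟩ := mem_half.1 hk1
    obtain ⟨x, _, rfl⟩ := mem_edges.1 (hB he)
    obtain ⟨x', _, rfl⟩ := mem_edges.1 (hB he')
    exact hne ((h.edge_eq (hke (mem_insert_self y _))).symm.trans (h.edge_eq (hke' (mem_insert_self y _))))
  · rw [disjoint_left]
    intro k hk hf
    obtain ⟨e, he, hk⟩ := mem_biUnion.1 hk
    obtain ⟨_, hke⟩ := mem_filter.1 hk
    obtain ⟨y, hy, rfl⟩ := mem_flags.1 hf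
    obtain ⟨x, hx, rfl⟩ := mem_edges.1 (hB he)
    exact h.not_fix hx (hke (by simp)) hy

end Scaling

end RawRibbon

end RibbonPaper

open RibbonPaper RawRibbon in
/-- scaling relation for `Q`. -/
theorem statement_1 {X : Type} [Fintype X] [DecidableEq X] {R : Type} [Field R]
    (G : RawRibbon X) (hG : G.IsRibbon)
    (x y z w : Finset X → R) (r : ℕ → R) (lam mu : R) (hmu : mu ≠ 0) :
    Qpoly G (fun e => lam * x e) (fun e => lam * y e)
        (fun e => lam * mu⁻¹ ^ 2 * z e) (fun e => lam * mu⁻¹ ^ 2 * w e)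
        (fun n => mu ^ n * r n) =
      lam ^ G.edges.card * mu ^ G.flags.card * Qpoly G x y z w r := by
  have hP := hG.pre
  unfold Qpoly
  rw [mul_sum]
  refine sum_congr rfl fun A hA => ?_
  rw [mul_sum]
  refine sum_congr rfl fun B hB => ?_
  rw [mem_powerset] at hA hB
  have hs := (hP.dual hA).sum_degB hB
  rw [hP.dual_flags hA] at hs
  rw [hP.dual_edges hA] at hB ⊢
  have c1 : (A ∩ B).card + ((G.edges \ A) ∩ B).card = B.card := by
    rw [← card_union_of_disjoint]
    · congr 1
      ext e
      have := @hB e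
      simp only [mem_union, mem_inter, mem_sdiff]
      tauto
    · rw [disjoint_left]
      intro e
      simp only [mem_inter, mem_sdiff]
      tauto
  have c2 : (A ∩ (G.edges \ B)).card + ((G.edges \ A) ∩ (G.edges \ B)).card + B.card =
      G.edges.card := by
    rw [← card_union_of_disjoint, ← card_union_of_disjoint]
    · congr 1
      ext e
      have := @hB e
      have := @hA e
      simp only [mem_union, mem_inter, mem_sdiff]
      tauto
    · rw [disjoint_left]
      intro e
      simp only [mem_union, mem_inter, mem_sdiff]
      tauto
    · rw [disjoint_left]
      intro e
      simp only [mem_inter, mem_sdiff]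
      tauto
  obtain ⟨c, hc⟩ : ∃ c, c = lam * mu⁻¹ ^ 2 := ⟨_, rfl⟩
  simp only [← hc]
  have hc2 : c * mu ^ 2 = lam := by
    rw [hc]
    field_simp
  simp only [prod_mul_distrib, prod_const, prod_pow_eq_pow_sum, hs]
  rw [← c2, ← c1]
  generalize (A ∩ B).card = a
  generalize ((G.edges \ A) ∩ B).card = b
  have e1 : mu ^ (2 * (a + b) + G.flags.card) =
      (mu ^ 2) ^ a * (mu ^ 2) ^ b * mu ^ G.flags.card := by
    rw [pow_add, pow_mul, pow_add]
  have e2 : ∀ n, c ^ n * (mu ^ 2) ^ n = lam ^ n := by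
    intro n
    rw [← mul_pow, hc2]
  rw [e1]
  simp only [pow_add, ← e2 a, ← e2 b]
  ring
end

section
/- Composition of partial dualities: for any ribbon graph with flags G, any subset E' ⊆ E(G) and any edge e ∉ E', one has (G^{E'})^{{e}} = G^{E' ∪ {e}} as triples of permutations (using the canonical identification of the edges of G^{E'} with those of G). -/
set_option linter.unusedSectionVars false

open Finset

namespace RibbonPaper.RawRibbon

lemma pr_apply {X : Type} [Fintype X] [DecidableEq X] (f : Equiv.Perm X) (S : Finset X)
    (h : ∀ x : X, x ∈ S ↔ f x ∈ S) (x : X) :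
    permRestrict f S x = if x ∈ S then f x else x := by
  rw [permRestrict, dif_pos h]
  split_ifs with hx
  · rw [Equiv.Perm.ofSubtype_apply_of_mem _ hx]; rfl
  · exact Equiv.Perm.ofSubtype_apply_of_not_mem _ hx

lemma edge_inv {X : Type} [Fintype X] [DecidableEq X] (G : RawRibbon X) (hG : G.IsRibbon)
    (e : Finset X) (he : e ∈ G.edges) (x : X) (hx : x ∈ e) :
    e = {x, G.th x, G.s1 x, G.s1 (G.th x)} := by
  obtain ⟨h1, h2, h3, -⟩ := hG
  have ht : ∀ y, G.th (G.th y) = y := fun y => by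
    have := congrArg (fun f : Equiv.Perm X => f y) h1
    simpa [pow_two] using this
  have hs : ∀ y, G.s1 (G.s1 y) = y := fun y => by
    have := congrArg (fun f : Equiv.Perm X => f y) h2
    simpa [pow_two] using this
  have hc : ∀ y, G.th (G.s1 y) = G.s1 (G.th y) := fun y => by
    have := congrArg (fun f : Equiv.Perm X => f y) h3
    simpa using this
  simp only [edges, Finset.mem_image, Finset.mem_filter] at he
  obtain ⟨y, -, rfl⟩ := he
  simp only [Finset.mem_insert, Finset.mem_singleton] at hx
  rcases hx with rfl | rfl | rfl | rfl <;> ext z <;>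
    simp only [Finset.mem_insert, Finset.mem_singleton, ht, hs, hc] <;> tauto

lemma inv_of {X : Type} (f : Equiv.Perm X) (S : Finset X) (hf : ∀ x, f (f x) = x)
    (h : ∀ x ∈ S, f x ∈ S) (x : X) : x ∈ S ↔ f x ∈ S :=
  ⟨h x, fun hx => by simpa [hf] using h _ hx⟩

end RibbonPaper.RawRibbon

open RibbonPaper RawRibbon in
/-- composition of partial dualities. -/
theorem statement_6 {X : Type} [Fintype X] [DecidableEq X]
    (G : RawRibbon X) (hG : G.IsRibbon) (E' : Finset (Finset X)) (hE : E' ⊆ G.edges)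
    (e : Finset X) (he : e ∈ G.edges) (he' : e ∉ E') :
    (G.partialDual E').partialDual {e} = G.partialDual (insert e E') := by
  have key := edge_inv G hG
  obtain ⟨h1, h2, h3, -⟩ := hG
  have ht : ∀ y, G.th (G.th y) = y := fun y => by
    have := congrArg (fun f : Equiv.Perm X => f y) h1
    simpa [pow_two] using this
  have hs : ∀ y, G.s1 (G.s1 y) = y := fun y => by
    have := congrArg (fun f : Equiv.Perm X => f y) h2
    simpa [pow_two] using this
  have kt : ∀ a ∈ G.edges, ∀ x ∈ a, G.th x ∈ a := fun a ha x hx => by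
    rw [key a ha x hx]; simp
  have ks : ∀ a ∈ G.edges, ∀ x ∈ a, G.s1 x ∈ a := fun a ha x hx => by
    rw [key a ha x hx]; simp
  have hdisj : ∀ x ∈ e, x ∉ crossSet E' := by
    intro x hx hx'
    simp only [crossSet, Finset.mem_biUnion, id] at hx'
    obtain ⟨a, ha, hxa⟩ := hx'
    apply he'
    rw [key e he x hx, ← key a (hE ha) x hxa]
    exact ha
  have hu : crossSet (insert e E') = e ∪ crossSet E' := by
    simp [crossSet, Finset.biUnion_insert]
  have h1e : crossSet {e} = e := by simp [crossSet]
  have te := inv_of G.th e ht (kt e he)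
  have se := inv_of G.s1 e hs (ks e he)
  have tS := inv_of G.th (crossSet E') ht (fun x hx => by
    simp only [crossSet, Finset.mem_biUnion, id] at hx ⊢
    obtain ⟨a, ha, hxa⟩ := hx
    exact ⟨a, ha, kt a (hE ha) x hxa⟩)
  have sS := inv_of G.s1 (crossSet E') hs (fun x hx => by
    simp only [crossSet, Finset.mem_biUnion, id] at hx ⊢
    obtain ⟨a, ha, hxa⟩ := hx
    exact ⟨a, ha, ks a (hE ha) x hxa⟩)
  generalize hSS : crossSet E' = S at *
  have inc : ∀ (f : Equiv.Perm X) (T : Finset X), (∀ x, x ∈ T ↔ f x ∈ T) →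
      ∀ x, x ∈ Tᶜ ↔ f x ∈ Tᶜ := fun f T h x => by
    simp only [Finset.mem_compl, ← h x]
  have inu : ∀ (f : Equiv.Perm X), (∀ x, x ∈ e ↔ f x ∈ e) → (∀ x, x ∈ S ↔ f x ∈ S) →
      ∀ x, x ∈ e ∪ S ↔ f x ∈ e ∪ S := fun f h h' x => by
    simp only [Finset.mem_union, ← h x, ← h' x]
  have Ht : ∀ x, (G.partialDual E').th x = if x ∈ S then G.s1 x else G.th x := fun x => by
    simp only [partialDual, hSS, Equiv.Perm.mul_apply, pr_apply _ _ sS, pr_apply _ _ (inc _ _ tS),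
      Finset.mem_compl]
    have := tS x
    split_ifs <;> tauto
  have Hs : ∀ x, (G.partialDual E').s1 x = if x ∈ S then G.th x else G.s1 x := fun x => by
    simp only [partialDual, hSS, Equiv.Perm.mul_apply, pr_apply _ _ tS, pr_apply _ _ (inc _ _ sS),
      Finset.mem_compl]
    have := tS x
    split_ifs <;> tauto
  have H0 : ∀ x, (G.partialDual E').s0 x = G.s0 (if x ∈ S then G.th (G.s1 x) else x) := fun x => by
    simp only [partialDual, hSS, Equiv.Perm.mul_apply, pr_apply _ _ tS, pr_apply _ _ sS]
    have := sS x
    split_ifs <;> tauto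
  have Hte : ∀ x, x ∈ e ↔ (G.partialDual E').th x ∈ e := fun x => by
    rw [Ht]; split_ifs; exacts [se x, te x]
  have Hse : ∀ x, x ∈ e ↔ (G.partialDual E').s1 x ∈ e := fun x => by
    rw [Hs]; split_ifs; exacts [te x, se x]
  generalize G.partialDual E' = H at *
  simp only [partialDual, hu, h1e, RawRibbon.mk.injEq]
  refine ⟨?_, ?_, ?_⟩ <;> ext x <;>
    simp only [Equiv.Perm.mul_apply, pr_apply _ _ Hte, pr_apply _ _ Hse,
      pr_apply _ _ (inc _ _ Hte), pr_apply _ _ (inc _ _ Hse),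
      pr_apply _ _ (inu _ te tS), pr_apply _ _ (inu _ se sS),
      pr_apply _ _ (inc _ _ (inu _ te tS)), pr_apply _ _ (inc _ _ (inu _ se sS)),
      Finset.mem_compl, Finset.mem_union, Ht, Hs, H0] <;>
    by_cases b : x ∈ e <;> by_cases c : x ∈ S <;>
    first
    | exact absurd c (hdisj x b)
    | simp [b, c, ← te, ← se, ← tS, ← sS]
end
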